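/- arXiv:1810.10925 — 3 statements merged into one kernel-verified Lean document; each statement's English description precedes it below -/
import Mathlib

section
/- Let g ≥ 2, h, and t be integers with t ≥ 2 and g^t ≤ h (equivalently 2 ≤ t ≤ log h / log g). Then there exists a partition of ℕ into pairwise disjoint sets W_0, W_1, …, W_{h-1} such that each W_r is a union of infinitely many intervals each consisting of at least t consecutive integers, and the set A = A_g(W_0) ∪ A_g(W_1) ∪ ⋯ ∪ A_g(W_{h-1}) is an asymptotic basis of order h but is NOT a minimal asymptotic basis of order h. -/
/-- `AgSet g W` is the set of all integers of the form `∑ f ∈ F, a f * g ^ f`,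
where `F` is a finite nonempty subset of `W` and `1 ≤ a f ≤ g - 1` for each `f ∈ F`. -/
def AgSet (g : ℕ) (W : Set ℕ) : Set ℕ :=
  {n | ∃ F : Finset ℕ, F.Nonempty ∧ ↑F ⊆ W ∧ ∃ a : ℕ → ℕ,
    (∀ f ∈ F, 1 ≤ a f ∧ a f ≤ g - 1) ∧ n = ∑ f ∈ F, a f * g ^ f}

/-- `FoldSum h A` is the `h`-fold sumset `hA`, the set of all sums `a₁ + ⋯ + a_h`
with each `aᵢ ∈ A`. -/
def FoldSum (h : ℕ) (A : Set ℕ) : Set ℕ :=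
  {n | ∃ x : Fin h → ℕ, (∀ i, x i ∈ A) ∧ n = ∑ i, x i}

/-- `A` is an asymptotic basis of order `h` if every sufficiently large integer lies in `hA`. -/
def IsAsymptoticBasis (h : ℕ) (A : Set ℕ) : Prop :=
  ∀ᶠ n in Filter.atTop, n ∈ FoldSum h A

/-- `A` is a minimal asymptotic basis of order `h` if it is an asymptotic basis of order `h`
and no proper subset of `A` is an asymptotic basis of order `h`. -/
def IsMinimalAsymptoticBasis (h : ℕ) (A : Set ℕ) : Prop :=
  IsAsymptoticBasis h A ∧ ∀ B : Set ℕ, B ⊂ A → ¬ IsAsymptoticBasis h B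

open Finset in
lemma ag_mem (g : ℕ) (W : Set ℕ) (F : Finset ℕ) (a : ℕ → ℕ) (ha : ∀ f ∈ F, a f < g)
    (hW : ∀ f ∈ F, a f ≠ 0 → f ∈ W) (hne : ∑ f ∈ F, a f * g ^ f ≠ 0) :
    ∑ f ∈ F, a f * g ^ f ∈ AgSet g W := by
  have hs : ∑ f ∈ F with a f ≠ 0, a f * g ^ f = ∑ f ∈ F, a f * g ^ f := by
    apply Finset.sum_subset (Finset.filter_subset _ _)
    intro x hx hx'
    have : a x = 0 := by
      by_contra h0
      exact hx' (Finset.mem_filter.2 ⟨hx, h0⟩)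
    simp [this]
  refine ⟨F.filter (fun f => a f ≠ 0), ?_, ?_, a, ?_, hs.symm⟩
  · rw [Finset.nonempty_iff_ne_empty]
    intro h0
    rw [h0] at hs
    exact hne (by simpa using hs.symm)
  · intro f hf
    have := Finset.mem_filter.1 (Finset.mem_coe.1 hf)
    exact hW f this.1 this.2
  · intro f hf
    have := Finset.mem_filter.1 hf
    have h1 := ha f this.1
    have h2 := this.2
    omega

lemma ag_single (g : ℕ) (W : Set ℕ) (f a : ℕ) (h1 : 1 ≤ a) (h2 : a < g) (hf : f ∈ W) :
    a * g ^ f ∈ AgSet g W :=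
  ⟨{f}, by simp, by simpa using hf, fun _ => a, by simp; omega, by simp⟩

lemma ag_zero_mem (g : ℕ) (W : Set ℕ) (y : ℕ) (hy : y ∈ AgSet g W) (h0 : y % g ≠ 0) :
    0 ∈ W := by
  obtain ⟨F, -, hFW, a, ha, rfl⟩ := hy
  by_contra hW
  apply h0
  apply Nat.mod_eq_zero_of_dvd
  apply Finset.dvd_sum
  intro f hf
  have : f ≠ 0 := by
    rintro rfl
    exact hW (hFW hf)
  exact Dvd.dvd.mul_left (dvd_pow_self g this) _

lemma digit_sum (g n m : ℕ) : ∑ i ∈ Finset.range m, (n / g ^ i % g) * g ^ i = n % g ^ m := by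
  induction m with
  | zero => simp [Nat.mod_one]
  | succ m ih => rw [Finset.sum_range_succ, ih, Nat.mod_pow_succ]; ring

lemma distribute (h lo M N : ℕ) (hM : lo ≤ M) (h1 : h * lo ≤ N) (h2 : N ≤ h * M) :
    ∃ e : Fin h → ℕ, (∀ i, lo ≤ e i ∧ e i ≤ M) ∧ ∑ i, e i = N := by
  induction h generalizing N with
  | zero => exact ⟨fun _ => 0, fun i => i.elim0, by simp at *; omega⟩
  | succ h ih =>
    have hex : ∃ q, lo ≤ q ∧ q ≤ M ∧ q ≤ N ∧ h * lo ≤ N - q ∧ N - q ≤ h * M := by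
      rw [Nat.succ_mul] at h1 h2
      have : h * lo ≤ h * M := Nat.mul_le_mul_left _ hM
      by_cases hc : N ≤ h * M + lo
      · exact ⟨lo, le_rfl, hM, by omega, by omega, by omega⟩
      · exact ⟨N - h * M, by omega, by omega, by omega, by omega, by omega⟩
    obtain ⟨q, q1, q2, q3, q4, q5⟩ := hex
    obtain ⟨e, he, hes⟩ := ih (N - q) q4 q5
    refine ⟨Fin.cons q e, ?_, ?_⟩
    · intro i
      refine Fin.cases ?_ ?_ i
      · simp [q1, q2]
      · intro j; simpa using he j
    · rw [Fin.sum_univ_succ]; simp [hes]; omega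

lemma fold_of_multiset (B : Set ℕ) (s : Multiset ℕ) (hB : ∀ x ∈ s, x ∈ B) :
    s.sum ∈ FoldSum (Multiset.card s) B := by
  induction s using Quotient.inductionOn with
  | _ l =>
    refine ⟨fun i => l[i.1]'(by simpa using i.2), ?_, ?_⟩
    · intro i
      apply hB
      simp
    · exact (Fin.sum_univ_getElem l).symm

lemma fill_zeros (B : Set ℕ) (Y h n : ℕ) (hn : h * Y ≤ n) (hY : 0 < Y)
    (split : ∀ y ∈ B, Y ≤ y → ∃ u ∈ B, ∃ v ∈ B, u + v = y) (h0 : 0 ∉ B) (z : ℕ) :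
    ∀ s : Multiset ℕ, Multiset.card s = h → (∀ x ∈ s, x = 0 ∨ x ∈ B) → s.sum = n →
      s.count 0 = z → n ∈ FoldSum h B := by
  induction z with
  | zero =>
    intro s hc hs hsum hz
    rw [← hc, ← hsum]
    apply fold_of_multiset
    intro x hx
    rcases hs x hx with rfl | hx'
    · exact absurd hx (Multiset.count_eq_zero.1 hz)
    · exact hx'
  | succ z ih =>
    intro s hc hs hsum hz
    have hmem : 0 ∈ s := Multiset.count_pos.1 (by omega)
    obtain ⟨s', rfl⟩ := Multiset.exists_cons_of_mem hmem
    have hy : ∃ y ∈ s', Y ≤ y := by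
      by_contra hcon
      push Not at hcon
      have := Multiset.sum_le_card_nsmul s' Y (fun x hx => (hcon x hx).le)
      simp at hc hsum this
      subst hc
      rw [hsum] at this
      rw [Nat.succ_mul] at hn
      omega
    obtain ⟨y, hys, hyY⟩ := hy
    obtain ⟨s'', rfl⟩ := Multiset.exists_cons_of_mem hys
    have hyB : y ∈ B := by
      rcases hs y (by simp) with h | h
      · omega
      · exact h
    obtain ⟨u, hu, v, hv, huv⟩ := split y hyB hyY
    have hu0 : 0 ≠ u := fun h => h0 (h ▸ hu)
    have hv0 : 0 ≠ v := fun h => h0 (h ▸ hv)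
    have hy0 : 0 ≠ y := by omega
    apply ih (u ::ₘ v ::ₘ s'')
    · simpa using hc
    · intro x hx
      simp only [Multiset.mem_cons] at hx
      rcases hx with rfl | rfl | hx
      · exact Or.inr hu
      · exact Or.inr hv
      · exact hs x (by simp [hx])
    · simp at hsum ⊢; omega
    · rw [Multiset.count_cons_of_ne hu0, Multiset.count_cons_of_ne hv0]
      rw [Multiset.count_cons_self, Multiset.count_cons_of_ne hy0] at hz
      omega

/-- The class of a position. -/
def posClass (h t f : ℕ) : ℕ :=
  if f % (h + t) < h then 0 else 1 + (f / (h + t)) % (h - 1)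

/-- The classes. -/
def clW (h t r : ℕ) : Set ℕ := {f | posClass h t f = r}

lemma split_lemma (g h t : ℕ) (hg : 2 ≤ g) (hh : 2 ≤ h) (A : Set ℕ)
    (hA : ∀ r, r < h → AgSet g (clW h t r) ⊆ A) (hlt : ∀ f, posClass h t f < h)
    (r : ℕ) (hr : r < h) (y : ℕ) (hy : y ∈ AgSet g (clW h t r)) (hY : g ^ 3 ≤ y) :
    ∃ u ∈ A \ {1 + g}, ∃ v ∈ A \ {1 + g}, u + v = y := by
  have hy' := hy
  obtain ⟨F, hF, hFW, a, ha, rfl⟩ := hy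
  have hf3 : ∃ f ∈ F, 3 ≤ f := by
    by_contra hcon
    push Not at hcon
    have : ∑ f ∈ F, a f * g ^ f ≤ ∑ f ∈ Finset.range 3, (g - 1) * g ^ f := by
      calc ∑ f ∈ F, a f * g ^ f ≤ ∑ f ∈ F, (g - 1) * g ^ f :=
            Finset.sum_le_sum fun f hf => Nat.mul_le_mul_right _ (ha f hf).2
        _ ≤ _ := Finset.sum_le_sum_of_subset
            (fun f hf => Finset.mem_range.2 (hcon f hf))
    obtain ⟨m, rfl⟩ : ∃ m, g = m + 1 := ⟨g - 1, by omega⟩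
    simp only [Finset.sum_range_succ, Finset.sum_range_zero, Nat.add_sub_cancel] at this
    have h2 : (m + 1) ^ 3 = m * (m+1)^0 + m * (m+1)^1 + m * (m+1)^2 + 1 := by ring
    omega
  obtain ⟨f, hfF, hf⟩ := hf3
  have hbig : ∀ k, 2 ≤ k → 1 + g < g ^ k := by
    intro k hk
    have : g ^ 2 ≤ g ^ k := Nat.pow_le_pow_right (by omega) hk
    nlinarith
  have hbig' : ∀ k b, 2 ≤ k → 1 ≤ b → 1 + g < b * g ^ k := by
    intro k b hk hb
    have := hbig k hk
    nlinarith
  have haf := ha f hfF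
  have hfr : f ∈ clW h t r := hFW hfF
  have key : ∀ k b, 2 ≤ k → 1 ≤ b → b < g → b * g ^ k ∈ A \ {1 + g} := by
    intro k b hk hb hbg
    refine ⟨hA _ (hlt k) (ag_single g _ k b hb hbg rfl), ?_⟩
    have := hbig' k b hk hb
    simp only [Set.mem_singleton_iff]; omega
  have hsum := Finset.add_sum_erase F (fun f => a f * g ^ f) hfF
  by_cases hE : (F.erase f).Nonempty
  · have hrest : ∑ x ∈ F.erase f, a x * g ^ x ∈ AgSet g (clW h t r) :=
      ⟨F.erase f, hE, fun x hx => hFW (Finset.mem_of_mem_erase hx), a,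
        fun x hx => ha x (Finset.mem_of_mem_erase hx), rfl⟩
    by_cases hx : ∑ x ∈ F.erase f, a x * g ^ x = 1 + g
    · have h0 : 0 ∈ clW h t r := by
        apply ag_zero_mem g _ _ hrest
        rw [hx, Nat.add_mod_right, Nat.mod_eq_of_lt (by omega)]; omega
      have hr0 : r = 0 := by
        rw [← show posClass h t 0 = r from h0]
        simp [posClass]; omega
      subst hr0
      have h1 : 1 ∈ clW h t 0 := by
        show posClass h t 1 = 0
        rw [posClass, Nat.mod_eq_of_lt (by omega), if_pos (by omega)]
      refine ⟨a f * g ^ f + 1, ⟨hA 0 hr ?_, ?_⟩, g, ⟨hA 0 hr ?_, ?_⟩, ?_⟩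
      · refine ⟨{f, 0}, by simp, ?_, fun i => if i = f then a f else 1, ?_, ?_⟩
        · intro i hi
          simp at hi
          rcases hi with rfl | rfl
          · exact hfr
          · exact h0
        · intro i _
          simp only
          split_ifs
          · exact haf
          · omega
        · rw [Finset.sum_pair (by omega)]
          simp
          omega
      · have := hbig' f (a f) (by omega) haf.1
        simp only [Set.mem_singleton_iff]; omega
      · have := ag_single g (clW h t 0) 1 1 le_rfl (by omega) h1
        simpa using this
      · simp
      · rw [← hsum, hx]; ring
    · exact ⟨_, key f (a f) (by omega) haf.1 (by omega), _, ⟨hA r hr hrest, hx⟩, hsum⟩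
  · rw [Finset.not_nonempty_iff_eq_empty] at hE
    rw [hE, Finset.sum_empty, add_zero] at hsum
    by_cases h2 : 2 ≤ a f
    · refine ⟨_, key f 1 (by omega) le_rfl (by omega), _,
        key f (a f - 1) (by omega) (by omega) (by omega), ?_⟩
      rw [← hsum, ← Nat.add_mul]; congr 1; omega
    · have h1 : a f = 1 := by omega
      refine ⟨_, key (f-1) 1 (by omega) le_rfl (by omega), _,
        key (f-1) (g - 1) (by omega) (by omega) (by omega), ?_⟩
      rw [← hsum, ← Nat.add_mul, h1, one_mul, show 1 + (g - 1) = g by omega, ← pow_succ']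
      congr 1; omega

lemma block_sum (g P : ℕ) (e : ℕ → ℕ) (hP : 0 < P) (he : ∀ k, e k < g ^ P) (K : ℕ) :
    ∑ f ∈ Finset.range (K * P), (e (f / P) / g ^ (f % P) % g) * g ^ f =
      ∑ k ∈ Finset.range K, e k * (g ^ P) ^ k := by
  induction K with
  | zero => simp
  | succ K ih =>
    rw [Finset.sum_range_succ, Nat.succ_mul, Finset.sum_range_add, ih]
    congr 1
    have := digit_sum g (e K) P
    rw [Nat.mod_eq_of_lt (he K)] at this
    rw [← pow_mul]
    conv_rhs => rw [← this, Finset.sum_mul]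
    apply Finset.sum_congr rfl
    intro j hj
    have hj := Finset.mem_range.1 hj
    rw [show (K * P + j) / P = K by
        rw [mul_comm, Nat.mul_add_div hP, Nat.div_eq_of_lt hj, add_zero],
      show (K * P + j) % P = j by
        rw [mul_comm, Nat.mul_add_mod, Nat.mod_eq_of_lt hj], pow_add, mul_comm P K]
    ring

/-- If every block value is small enough, `n` is a sum of `h` elements from class zero. -/
lemma carry_case (g h t n : ℕ) (hg : 2 ≤ g) (ht : 2 ≤ t) (hh : 2 ≤ h)
    (hN : ∀ k, n / (g ^ (h + t)) ^ k % g ^ (h + t) ≤ h * (g ^ h - 1))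
    (k0 : ℕ) (hk0 : 1 ≤ k0) (hk1 : h ≤ n / (g ^ (h + t)) ^ k0 % g ^ (h + t)) :
    n ∈ FoldSum h (AgSet g (clW h t 0) \ {1 + g}) := by
  have hgh : h < g ^ h := Nat.lt_pow_self (by omega)
  have hex : ∀ k, ∃ e : Fin h → ℕ, (∀ i, (if k = k0 then 1 else 0) ≤ e i ∧ e i ≤ g ^ h - 1) ∧
      ∑ i, e i = n / (g ^ (h + t)) ^ k % g ^ (h + t) := by
    intro k
    apply distribute
    · split_ifs <;> omega
    · split_ifs with hk
      · subst hk; simpa using hk1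
      · simp
    · exact hN k
  choose e he hes using hex
  have hPh : g ^ h ≤ g ^ (h + t) := Nat.pow_le_pow_right (by omega) (by omega)
  have hG : 1 < g ^ (h + t) := by omega
  have hk0n : k0 < n := by
    by_contra hcon
    have : n < (g ^ (h + t)) ^ k0 := lt_of_lt_of_le (Nat.lt_pow_self hG)
      (Nat.pow_le_pow_right (by omega) (by omega))
    rw [Nat.div_eq_of_lt this] at hk1
    simp at hk1; omega
  refine ⟨fun i => ∑ k ∈ Finset.range n, e k i * (g ^ (h + t)) ^ k, ?_, ?_⟩
  · intro i
    have hlow : 1 + g < ∑ k ∈ Finset.range n, e k i * (g ^ (h + t)) ^ k := by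
      have h1 : e k0 i * (g ^ (h + t)) ^ k0 ≤ ∑ k ∈ Finset.range n, e k i * (g ^ (h + t)) ^ k :=
        Finset.single_le_sum (f := fun k => e k i * (g ^ (h + t)) ^ k)
          (fun _ _ => Nat.zero_le _) (Finset.mem_range.2 hk0n)
      have h2 := (he k0 i).1
      rw [if_pos rfl] at h2
      have h3 : (g ^ (h + t)) ^ 1 ≤ (g ^ (h + t)) ^ k0 := Nat.pow_le_pow_right (by omega) hk0
      have h4 : g ^ 2 ≤ g ^ (h + t) := Nat.pow_le_pow_right (by omega) (by omega)
      have h5 : (g ^ (h + t)) ^ k0 ≤ e k0 i * (g ^ (h + t)) ^ k0 := Nat.le_mul_of_pos_left _ h2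
      rw [pow_one] at h3
      have h6 : 1 + g < g ^ 2 := by nlinarith
      omega
    refine ⟨?_, ?_⟩
    · have hb := block_sum g (h + t) (fun k => e k i) (by omega)
        (fun k => by have := (he k i).2; omega) n
      show ∑ k ∈ Finset.range n, e k i * (g ^ (h + t)) ^ k ∈ _
      rw [← hb] at hlow ⊢
      apply ag_mem g _ _ (fun f => e (f / (h + t)) i / g ^ (f % (h + t)) % g)
      · intro f _
        exact Nat.mod_lt _ (by omega)
      · intro f _ hf
        show posClass h t f = 0
        rw [posClass, if_pos]
        by_contra hcon
        apply hf
        have h1 := (he (f / (h + t)) i).2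
        have h2 : g ^ h ≤ g ^ (f % (h + t)) := Nat.pow_le_pow_right (by omega) (by omega)
        rw [Nat.div_eq_of_lt (by omega), Nat.zero_mod]
      · omega
    · simp only [Set.mem_singleton_iff]; omega
  · rw [Finset.sum_comm]
    have : ∀ k, ∑ i, e k i * (g ^ (h + t)) ^ k =
        (n / (g ^ (h + t)) ^ k % g ^ (h + t)) * (g ^ (h + t)) ^ k := by
      intro k
      rw [← Finset.sum_mul, hes]
    simp only [this]
    rw [digit_sum, Nat.mod_eq_of_lt (Nat.lt_pow_self hG)]

/-- The part of `n` in class `r`. -/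
def part (g h t n r : ℕ) : ℕ :=
  ∑ f ∈ Finset.range n with posClass h t f = r, (n / g ^ f % g) * g ^ f

lemma part_zero_ge (g h t n k : ℕ) (hg : 2 ≤ g) (hh : 2 ≤ h) :
    (n / (g ^ (h + t)) ^ k % g ^ h) * (g ^ (h + t)) ^ k ≤ part g h t n 0 := by
  rw [← digit_sum, Finset.sum_mul]
  have hz : ∀ f, n ≤ f → n / g ^ f = 0 := fun f hf =>
    Nat.div_eq_of_lt (lt_of_le_of_lt hf (Nat.lt_pow_self (by omega)))
  have e1 : part g h t n 0 = ∑ f ∈ Finset.range (n + (k * (h + t) + h)) with posClass h t f = 0,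
      (n / g ^ f % g) * g ^ f := by
    apply Finset.sum_subset
    · apply Finset.filter_subset_filter
      apply Finset.range_subset_range.2; omega
    · intro f hf hf'
      simp at hf hf'
      rw [hz f (by by_contra hc; exact hf' (by omega) hf.2)]
      simp
  rw [e1]
  have e2 : ∑ i ∈ Finset.range h, n / (g ^ (h + t)) ^ k / g ^ i % g * g ^ i * (g ^ (h + t)) ^ k
      = ∑ f ∈ (Finset.range h).image (fun i => k * (h + t) + i), (n / g ^ f % g) * g ^ f := by
    rw [Finset.sum_image (by intro a _ b _ hab; simpa using hab)]
    apply Finset.sum_congr rfl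
    intro i _
    rw [Nat.div_div_eq_div_mul, ← pow_mul, mul_comm (h + t) k, ← pow_add, mul_assoc, ← pow_add,
      add_comm i]
  rw [e2]
  apply Finset.sum_le_sum_of_subset
  intro f hf
  simp only [Finset.mem_image, Finset.mem_range] at hf
  obtain ⟨i, hi, rfl⟩ := hf
  simp only [Finset.mem_filter, Finset.mem_range]
  refine ⟨by omega, ?_⟩
  rw [posClass, if_pos]
  rw [mul_comm, Nat.mul_add_mod, Nat.mod_eq_of_lt (by omega)]; exact hi

lemma posClass_lt (h t f : ℕ) (hh : 2 ≤ h) : posClass h t f < h := by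
  rw [posClass]
  split_ifs
  · omega
  · have := Nat.mod_lt (f / (h + t)) (show 0 < h - 1 by omega)
    omega

lemma basis_main (g h t : ℕ) (hg : 2 ≤ g) (ht : 2 ≤ t) (hth : g ^ t ≤ h) (A : Set ℕ)
    (hA : A = ⋃ r ∈ Finset.range h, AgSet g (clW h t r)) (n : ℕ)
    (hn1 : h * g ^ 3 ≤ n) (hn2 : g ^ (h + t) ≤ n) : n ∈ FoldSum h (A \ {1 + g}) := by
  have htg : t < g ^ t := Nat.lt_pow_self (by omega)
  have hh : 2 ≤ h := by omega
  have hAr : ∀ r, r < h → AgSet g (clW h t r) ⊆ A := by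
    intro r hr y hy
    rw [hA]
    exact Set.mem_biUnion (Finset.mem_coe.2 (Finset.mem_range.2 hr)) hy
  have hpart : ∑ r ∈ Finset.range h, part g h t n r = n := by
    unfold part
    rw [Finset.sum_fiberwise_of_maps_to (fun f _ => Finset.mem_range.2 (posClass_lt h t f hh)),
      digit_sum, Nat.mod_eq_of_lt (Nat.lt_pow_self (by omega))]
  have hpm : ∀ r, part g h t n r ≠ 0 → part g h t n r ∈ AgSet g (clW h t r) := by
    intro r hr
    apply ag_mem g _ _ (fun f => n / g ^ f % g)
    · intro f _; exact Nat.mod_lt _ (by omega)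
    · intro f hf _; exact (Finset.mem_filter.1 hf).2
    · exact hr
  by_cases hx : part g h t n 0 = 1 + g
  · -- carry case
    have hE : ∀ k, (n / (g ^ (h + t)) ^ k % g ^ h) * (g ^ (h + t)) ^ k ≤ 1 + g :=
      fun k => hx ▸ part_zero_ge g h t n k hg hh
    have h6 : 1 + g < g ^ 2 := by nlinarith
    have hE0 : ∀ k, n / (g ^ (h + t)) ^ k % g ^ h ≤ 1 + g := by
      intro k
      refine le_trans (Nat.le_mul_of_pos_right _ (by positivity)) (hE k)
    have hE1 : ∀ k, 1 ≤ k → n / (g ^ (h + t)) ^ k % g ^ h = 0 := by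
      intro k hk
      by_contra hcon
      have h3 : (g ^ (h + t)) ^ 1 ≤ (g ^ (h + t)) ^ k :=
        Nat.pow_le_pow_right (by positivity) hk
      have h4 : g ^ 2 ≤ g ^ (h + t) := Nat.pow_le_pow_right (by omega) (by omega)
      have h5 := hE k
      have h7 : (g ^ (h + t)) ^ k ≤ (n / (g ^ (h + t)) ^ k % g ^ h) * (g ^ (h + t)) ^ k :=
        Nat.le_mul_of_pos_left _ (Nat.pos_of_ne_zero hcon)
      rw [pow_one] at h3
      omega
    have hmod : ∀ m, m % g ^ (h + t) = m % g ^ h + g ^ h * (m / g ^ h % g ^ t) := by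
      intro m
      rw [pow_add, Nat.mod_mul]
    have hgh : h < g ^ h := Nat.lt_pow_self (by omega)
    have hght : g ^ t + g + 1 ≤ g ^ h := by
      have a1 : g ^ (t + 1) ≤ g ^ h := Nat.pow_le_pow_right (by omega) (by omega)
      have a2 : g ^ 2 ≤ g ^ t := Nat.pow_le_pow_right (by omega) ht
      rw [pow_succ] at a1
      nlinarith
    have hN : ∀ k, n / (g ^ (h + t)) ^ k % g ^ (h + t) ≤ h * (g ^ h - 1) := by
      intro k
      rw [hmod]
      have b1 := hE0 k
      have b2 : n / (g ^ (h + t)) ^ k / g ^ h % g ^ t ≤ g ^ t - 1 :=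
        Nat.le_sub_one_of_lt (Nat.mod_lt _ (by positivity))
      have b3 : g ^ t * (g ^ h - 1) ≤ h * (g ^ h - 1) := Nat.mul_le_mul_right _ hth
      have b4 : g ^ h * (n / (g ^ (h + t)) ^ k / g ^ h % g ^ t) ≤ g ^ h * (g ^ t - 1) :=
        Nat.mul_le_mul_left _ b2
      have b5 : g ^ h * (g ^ t - 1) + g ^ h = g ^ t * (g ^ h - 1) + g ^ t := by
        obtain ⟨p, hp⟩ : ∃ p, g ^ h = p + 1 := ⟨g ^ h - 1, by omega⟩
        obtain ⟨q, hq⟩ : ∃ q, g ^ t = q + 1 := ⟨g ^ t - 1, by omega⟩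
        rw [hp, hq]; simp; ring
      omega
    have hk0 : ∃ k, 1 ≤ k ∧ n / (g ^ (h + t)) ^ k % g ^ (h + t) ≠ 0 := by
      by_contra hcon
      push Not at hcon
      have hG : 1 < g ^ (h + t) := Nat.one_lt_pow (by omega) (by omega)
      have c1 := digit_sum (g ^ (h + t)) n (n + 1)
      rw [Nat.mod_eq_of_lt (lt_trans (Nat.lt_succ_self n) (Nat.lt_pow_self hG)),
        Finset.sum_range_succ'] at c1
      rw [Finset.sum_eq_zero (fun k _ => by rw [hcon (k + 1) (by omega), zero_mul])] at c1
      have c2 := Nat.mod_lt n (show 0 < g ^ (h + t) by omega)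
      simp at c1
      omega
    obtain ⟨k, hk, hkn⟩ := hk0
    have hk1 : h ≤ n / (g ^ (h + t)) ^ k % g ^ (h + t) := by
      rw [hmod, hE1 k hk, zero_add] at hkn ⊢
      have : n / (g ^ (h + t)) ^ k / g ^ h % g ^ t ≠ 0 := fun h0 => hkn (by rw [h0, mul_zero])
      exact le_trans hgh.le (Nat.le_mul_of_pos_right _ (Nat.pos_of_ne_zero this))
    obtain ⟨x, hx1, hx2⟩ := carry_case g h t n hg ht hh hN k hk hk1
    exact ⟨x, fun i => ⟨hAr 0 (by omega) (hx1 i).1, (hx1 i).2⟩, hx2⟩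
  · refine fill_zeros (A \ {1 + g}) (g ^ 3) h n hn1 (by positivity) ?_ ?_ _
      ((Finset.range h).val.map (part g h t n)) (by simp) ?_ hpart rfl
    · intro y hy hY
      have hyA := hy.1
      rw [hA] at hyA
      simp only [Set.mem_iUnion, Finset.mem_range] at hyA
      obtain ⟨r, hr, hyr⟩ := hyA
      exact split_lemma g h t hg hh A hAr (fun f => posClass_lt h t f hh) r hr y hyr hY
    · intro h0
      have h0A := h0.1
      rw [hA] at h0A
      simp only [Set.mem_iUnion, Finset.mem_range] at h0A
      obtain ⟨r, hr, F, ⟨f, hf⟩, -, a, ha, hs⟩ := h0A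
      have := (Finset.sum_eq_zero_iff.1 hs.symm) f hf
      have h1 := (ha f hf).1
      have : 0 < a f * g ^ f := by positivity
      omega
    · intro y hy
      simp only [Multiset.mem_map, Finset.mem_val, Finset.mem_range] at hy
      obtain ⟨r, hr, rfl⟩ := hy
      by_cases hp : part g h t n r = 0
      · exact Or.inl hp
      · refine Or.inr ⟨hAr r hr (hpm r hp), ?_⟩
        intro hc
        simp only [Set.mem_singleton_iff] at hc
        have h0 : 0 ∈ clW h t r := by
          apply ag_zero_mem g _ _ (hpm r hp)
          rw [hc, Nat.add_mod_right, Nat.mod_eq_of_lt (by omega)]; omega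
        have hr0 : r = 0 := by
          rw [← show posClass h t 0 = r from h0]
          simp [posClass]; omega
        subst hr0
        exact hx hc

lemma clW_intervals (h t r : ℕ) (hh : 3 ≤ h) (hth : t ≤ h) (ht : 2 ≤ t) (hr : r < h) :
    ∃ a b : ℕ → ℕ,
        (∀ i, a i + t ≤ b i + 1) ∧ (∀ i, b i < a (i + 1)) ∧
        clW h t r = ⋃ i : ℕ, Set.Icc (a i) (b i) := by
  have hP : 0 < h + t := by omega
  by_cases hr0 : r = 0
  · subst hr0
    refine ⟨fun i => (h + t) * i, fun i => (h + t) * i + (h - 1), ?_, ?_, ?_⟩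
    · intro i; simp only; omega
    · intro i; simp only; rw [Nat.mul_succ]; omega
    · ext f
      simp only [clW, Set.mem_ofPred_eq, posClass, Set.mem_iUnion, Set.mem_Icc]
      have hd := Nat.div_add_mod f (h + t)
      constructor
      · intro hf
        have : f % (h + t) < h := by
          by_contra hc
          rw [if_neg hc] at hf; omega
        exact ⟨f / (h + t), by omega, by omega⟩
      · rintro ⟨i, h1, h2⟩
        rw [if_pos]
        obtain ⟨j, rfl⟩ := Nat.exists_eq_add_of_le h1
        rw [Nat.mul_add_mod, Nat.mod_eq_of_lt (by omega)]; omega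
  · refine ⟨fun i => (h + t) * ((h - 1) * i + (r - 1)) + h,
      fun i => (h + t) * ((h - 1) * i + (r - 1)) + h + (t - 1), ?_, ?_, ?_⟩
    · intro i; simp only; omega
    · intro i; simp only
      have : (h + t) * ((h - 1) * i + (r - 1) + 1) ≤ (h + t) * ((h - 1) * (i + 1) + (r - 1)) := by
        apply Nat.mul_le_mul_left
        rw [Nat.mul_succ]; omega
      rw [Nat.mul_succ] at this
      omega
    · ext f
      simp only [clW, Set.mem_ofPred_eq, posClass, Set.mem_iUnion, Set.mem_Icc]
      have hd := Nat.div_add_mod f (h + t)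
      have hm := Nat.mod_lt f hP
      constructor
      · intro hf
        have hc : ¬ f % (h + t) < h := by
          intro hc
          rw [if_pos hc] at hf; omega
        rw [if_neg hc] at hf
        have hd2 := Nat.div_add_mod (f / (h + t)) (h - 1)
        refine ⟨f / (h + t) / (h - 1), ?_⟩
        rw [show r - 1 = f / (h + t) % (h - 1) by omega, hd2]
        omega
      · rintro ⟨i, h1, h2⟩
        obtain ⟨j, rfl⟩ := Nat.exists_eq_add_of_le h1
        rw [add_assoc, Nat.mul_add_mod, Nat.mul_add_div hP, Nat.mod_eq_of_lt (by omega),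
          Nat.div_eq_of_lt (by omega), if_neg (by omega), add_zero, Nat.mul_add_mod,
          Nat.mod_eq_of_lt (by omega)]
        omega

/-- For integers `g ≥ 2`, `t ≥ 2` and `h` with `g ^ t ≤ h`, there is a
partition of ℕ into pairwise disjoint sets `W 0, …, W (h-1)` such that each `W r` is a
union of infinitely many intervals each consisting of at least `t` consecutive integers,
and `A = A_g(W 0) ∪ ⋯ ∪ A_g(W (h-1))` is an asymptotic basis of order `h` but is not a
minimal asymptotic basis of order `h`. -/
theorem stmt0 (g h t : ℕ) (hg : 2 ≤ g) (ht : 2 ≤ t) (hth : g ^ t ≤ h) :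
    ∃ W : ℕ → Set ℕ,
      (⋃ r ∈ Finset.range h, W r) = Set.univ ∧
      (∀ r < h, ∀ s < h, r ≠ s → Disjoint (W r) (W s)) ∧
      (∀ r < h, ∃ a b : ℕ → ℕ,
        (∀ i, a i + t ≤ b i + 1) ∧ (∀ i, b i < a (i + 1)) ∧
        W r = ⋃ i : ℕ, Set.Icc (a i) (b i)) ∧
      IsAsymptoticBasis h (⋃ r ∈ Finset.range h, AgSet g (W r)) ∧
      ¬ IsMinimalAsymptoticBasis h (⋃ r ∈ Finset.range h, AgSet g (W r)) := by
  have htg : t < g ^ t := Nat.lt_pow_self (by omega)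
  have hh : 3 ≤ h := by omega
  have hB : IsAsymptoticBasis h ((⋃ r ∈ Finset.range h, AgSet g (clW h t r)) \ {1 + g}) := by
    filter_upwards [Filter.eventually_ge_atTop (h * g ^ 3),
      Filter.eventually_ge_atTop (g ^ (h + t))] with n h1 h2
    exact basis_main g h t hg ht hth _ rfl n h1 h2
  refine ⟨clW h t, ?_, ?_, ?_, ?_, ?_⟩
  · ext f
    simp only [Set.mem_iUnion, Set.mem_univ, iff_true, Finset.mem_range]
    exact ⟨posClass h t f, posClass_lt h t f (by omega), rfl⟩
  · intro r _ s _ hrs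
    rw [Set.disjoint_left]
    intro f hf hf'
    exact hrs (Eq.trans (Eq.symm hf) hf')
  · intro r hr
    exact clW_intervals h t r hh (by omega) ht hr
  · filter_upwards [hB] with n hn
    obtain ⟨x, hx, hs⟩ := hn
    exact ⟨x, fun i => (hx i).1, hs⟩
  · intro hmin
    refine hmin.2 _ ?_ hB
    rw [Set.ssubset_iff_of_subset Set.sdiff_subset]
    refine ⟨1 + g, ?_, fun hc => hc.2 rfl⟩
    refine Set.mem_biUnion (Finset.mem_coe.2 (Finset.mem_range.2 (show 0 < h by omega))) ?_
    refine ⟨{0, 1}, by simp, ?_, fun _ => 1, fun _ _ => ⟨le_rfl, Nat.le_sub_one_of_lt hg⟩, by simp⟩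
    intro i hi
    simp at hi
    show posClass h t i = 0
    rw [posClass, Nat.mod_eq_of_lt (by omega), if_pos (by omega)]
end

section
/- Let g ≥ 2 be an integer and W ⊆ ℕ. Suppose there exists θ ∈ (0,1] such that the counting function W(x) = #{w ∈ W : w ≤ x} satisfies W(x) = θx + O(1). Then there exist positive constants c_1 and c_2 such that c_1 x^θ < A_g(W)(x) < c_2 x^θ for all sufficiently large x, where A_g(W)(x) = #{a ∈ A_g(W) : a ≤ x}. -/
/-- The counting function of a set `S ⊆ ℕ`: `countFn S x = #{s ∈ S : s ≤ x}`. -/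
noncomputable def countFn (S : Set ℕ) (x : ℕ) : ℕ := (S ∩ Set.Iic x).ncard

open Classical in
noncomputable def SFin (g : ℕ) (W : Set ℕ) : ℕ → Finset ℕ
  | 0 => {0}
  | k+1 => if k ∈ W then (SFin g W k ×ˢ Finset.range g).image (fun p => p.1 + p.2 * g ^ k)
      else SFin g W k

open Classical in
noncomputable def wCount (W : Set ℕ) (k : ℕ) : ℕ := ((Finset.range k).filter (· ∈ W)).card

lemma wCount_succ (W : Set ℕ) (k : ℕ) [Decidable (k ∈ W)] :
    wCount W (k+1) = wCount W k + if k ∈ W then 1 else 0 := by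
  unfold wCount
  rw [Finset.range_add_one, Finset.filter_insert]
  split_ifs <;> simp

lemma countFn_eq_wCount (W : Set ℕ) (x : ℕ) : countFn W x = wCount W (x+1) := by
  classical
  unfold countFn wCount
  rw [← Set.ncard_coe_finset]
  congr 1
  ext n
  simp [and_comm]

lemma SFin_zero_mem (g : ℕ) (hg : 2 ≤ g) (W : Set ℕ) (k : ℕ) : 0 ∈ SFin g W k := by
  induction k with
  | zero => simp [SFin]
  | succ k ih =>
    rw [SFin]
    split_ifs
    · exact Finset.mem_image.2 ⟨(0, 0), by simp [ih]; omega, by simp⟩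
    · exact ih

lemma SFin_lt (g : ℕ) (hg : 2 ≤ g) (W : Set ℕ) (k : ℕ) : ∀ n ∈ SFin g W k, n < g ^ k := by
  induction k with
  | zero => simp [SFin]
  | succ k ih =>
    intro n hn
    have hp : 0 < g ^ k := by positivity
    rw [SFin] at hn
    rw [pow_succ]
    split_ifs at hn
    · obtain ⟨⟨r, q⟩, hp, rfl⟩ := Finset.mem_image.1 hn
      simp only [Finset.mem_product, Finset.mem_range] at hp
      have := ih r hp.1
      have h2 : (q + 1) * g ^ k ≤ g * g ^ k := Nat.mul_le_mul_right _ hp.2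
      simp only
      nlinarith
    · have := ih n hn
      nlinarith

lemma SFin_card (g : ℕ) (hg : 2 ≤ g) (W : Set ℕ) (k : ℕ) :
    (SFin g W k).card = g ^ wCount W k := by
  classical
  induction k with
  | zero => simp [SFin, wCount]
  | succ k ih =>
    rw [SFin, wCount_succ]
    split_ifs
    · rw [Finset.card_image_of_injOn, Finset.card_product, ih, Finset.card_range, pow_succ]
      rintro ⟨r, q⟩ h ⟨r', q'⟩ h' heq
      simp only [Finset.coe_product, Set.mem_prod, Finset.mem_coe] at h h'
      have h1 := SFin_lt g hg W k r h.1
      have h2 := SFin_lt g hg W k r' h'.1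
      simp only at heq
      have hp : 0 < g ^ k := by positivity
      have e1 : r = r' := by
        have := congrArg (· % g ^ k) heq
        simpa [Nat.mod_eq_of_lt h1, Nat.mod_eq_of_lt h2] using this
      subst e1
      have e2 : q = q' := Nat.eq_of_mul_eq_mul_right hp (by omega)
      rw [e2]
    · simpa using ih

lemma SFin_sub (g : ℕ) (W : Set ℕ) (k : ℕ) : ∀ n ∈ SFin g W k,
    ∃ F : Finset ℕ, (∀ f ∈ F, f < k) ∧ ↑F ⊆ W ∧ ∃ a : ℕ → ℕ,
    (∀ f ∈ F, 1 ≤ a f ∧ a f ≤ g - 1) ∧ n = ∑ f ∈ F, a f * g ^ f := by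
  classical
  induction k with
  | zero =>
    intro n hn
    simp [SFin] at hn
    exact ⟨∅, by simp, by simp, fun _ => 0, by simp, by simp [hn]⟩
  | succ k ih =>
    intro n hn
    have key : n ∈ SFin g W k → ∃ F : Finset ℕ, (∀ f ∈ F, f < k + 1) ∧ ↑F ⊆ W ∧ ∃ a : ℕ → ℕ,
        (∀ f ∈ F, 1 ≤ a f ∧ a f ≤ g - 1) ∧ n = ∑ f ∈ F, a f * g ^ f := by
      intro h
      obtain ⟨F, h1, h2⟩ := ih n h
      exact ⟨F, fun f hf => (h1 f hf).trans (by omega), h2⟩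
    rw [SFin] at hn
    split_ifs at hn with hk
    · obtain ⟨⟨r, q⟩, hp, rfl⟩ := Finset.mem_image.1 hn
      simp only [Finset.mem_product, Finset.mem_range] at hp
      rcases Nat.eq_zero_or_pos q with rfl | hq
      · apply key; simpa using hp.1
      · obtain ⟨F, h1, h2, a, h3, h4⟩ := ih r hp.1
        have hkF : k ∉ F := fun h => (h1 k h).false
        have hne : ∀ f ∈ F, f ≠ k := fun f hf => (h1 f hf).ne
        refine ⟨insert k F, ?_, ?_, Function.update a k q, ?_, ?_⟩
        · intro f hf
          rcases Finset.mem_insert.1 hf with rfl | hf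
          · omega
          · have := h1 f hf; omega
        · intro f hf
          rcases Finset.mem_insert.1 (Finset.mem_coe.1 hf) with rfl | hf
          · exact hk
          · exact h2 hf
        · intro f hf
          rcases Finset.mem_insert.1 hf with rfl | hf
          · simp; omega
          · rw [Function.update_of_ne (hne f hf)]; exact h3 f hf
        · rw [Finset.sum_insert hkF, Function.update_self, add_comm]
          simp only
          rw [h4]
          congr 1
          apply Finset.sum_congr rfl
          intro f hf
          rw [Function.update_of_ne (hne f hf)]
    · exact key hn

lemma SFin_sup (g : ℕ) (hg : 2 ≤ g) (W : Set ℕ) (a : ℕ → ℕ) (k : ℕ) : ∀ F : Finset ℕ,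
    (∀ f ∈ F, f < k) → ↑F ⊆ W → (∀ f ∈ F, 1 ≤ a f ∧ a f ≤ g - 1) →
    ∑ f ∈ F, a f * g ^ f ∈ SFin g W k := by
  classical
  induction k with
  | zero =>
    intro F h _ _
    have : F = ∅ := Finset.eq_empty_of_forall_notMem fun f hf => by simpa using h f hf
    simp [this, SFin]
  | succ k ih =>
    intro F h1 h2 h3
    have := ih (F.erase k) (fun f hf => by
        have := h1 f (Finset.mem_of_mem_erase hf)
        have := Finset.ne_of_mem_erase hf
        omega) (fun f hf => h2 (Finset.mem_of_mem_erase (Finset.mem_coe.1 hf)))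
        (fun f hf => h3 f (Finset.mem_of_mem_erase hf))
    rw [SFin]
    by_cases hkF : k ∈ F
    · rw [if_pos (h2 hkF)]
      refine Finset.mem_image.2 ⟨(_, a k), Finset.mem_product.2 ⟨this, ?_⟩, ?_⟩
      · have := h3 k hkF
        simp; omega
      · exact Finset.sum_erase_add F (fun f => a f * g ^ f) hkF
    · rw [Finset.erase_eq_of_notMem hkF] at this
      split_ifs
      · exact Finset.mem_image.2 ⟨(∑ f ∈ F, a f * g ^ f, 0), Finset.mem_product.2 ⟨this, by simp; omega⟩, by simp⟩
      · exact this

lemma count_upper (g : ℕ) (hg : 2 ≤ g) (W : Set ℕ) (k x : ℕ) (hx : x < g ^ k) :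
    countFn (AgSet g W) x ≤ g ^ wCount W k := by
  rw [← SFin_card g hg, countFn, ← Set.ncard_coe_finset]
  apply Set.ncard_le_ncard _ (Finset.finite_toSet _)
  rintro n ⟨⟨F, _, h2, a, h3, rfl⟩, hn⟩
  refine SFin_sup g hg W a k F (fun f hf => ?_) h2 h3
  have h4 : a f * g ^ f ≤ ∑ f ∈ F, a f * g ^ f :=
    Finset.single_le_sum (f := fun f => a f * g ^ f) (fun _ _ => Nat.zero_le _) hf
  have h5 : 1 * g ^ f ≤ a f * g ^ f := Nat.mul_le_mul_right _ (h3 f hf).1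
  have h6 : (∑ f ∈ F, a f * g ^ f) ≤ x := hn
  exact (Nat.pow_lt_pow_iff_right (by omega)).1 (show g ^ f < g ^ k by omega)

lemma count_lower (g : ℕ) (hg : 2 ≤ g) (W : Set ℕ) (k x : ℕ) (hx : g ^ k ≤ x) :
    g ^ wCount W k ≤ countFn (AgSet g W) x + 1 := by
  have h0 := Finset.card_erase_add_one (SFin_zero_mem g hg W k)
  rw [← SFin_card g hg, countFn, ← h0, ← Set.ncard_coe_finset]
  gcongr
  · exact (Set.finite_Iic x).subset Set.inter_subset_right
  · intro n hn
    have hn := Finset.mem_erase.1 (Finset.mem_coe.1 hn)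
    refine ⟨?_, ((SFin_lt g hg W k n hn.2).trans_le hx).le⟩
    obtain ⟨F, _, h2, a, h3, h4⟩ := SFin_sub g W k n hn.2
    refine ⟨F, ?_, h2, a, h3, h4⟩
    rw [Finset.nonempty_iff_ne_empty]
    rintro rfl
    simp at h4
    exact hn.1 h4

/-- If `g ≥ 2`, `W ⊆ ℕ` and `θ ∈ (0,1]` with `W(x) = θx + O(1)`, then there
are positive constants `c₁, c₂` with `c₁ x^θ < A_g(W)(x) < c₂ x^θ` for all sufficiently
large `x`. -/
theorem stmt3 (g : ℕ) (hg : 2 ≤ g) (W : Set ℕ) (θ : ℝ) (hθ0 : 0 < θ) (hθ1 : θ ≤ 1)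
    (hW : ∃ C : ℝ, ∀ x : ℕ, |(countFn W x : ℝ) - θ * x| ≤ C) :
    ∃ c₁ c₂ : ℝ, 0 < c₁ ∧ 0 < c₂ ∧
      ∀ᶠ x : ℕ in Filter.atTop,
        c₁ * (x : ℝ) ^ θ < (countFn (AgSet g W) x : ℝ) ∧
        (countFn (AgSet g W) x : ℝ) < c₂ * (x : ℝ) ^ θ := by
  obtain ⟨C, hC⟩ := hW
  have hg0 : (0:ℝ) < g := by positivity
  have hg1 : (1:ℝ) ≤ g := by exact_mod_cast (by omega : 1 ≤ g)
  set d : ℝ := (g:ℝ) ^ (-C - 1 - θ) with hd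
  have hdpos : 0 < d := Real.rpow_pos_of_pos hg0 _
  refine ⟨d / 2, (g:ℝ) ^ C + 1, by positivity, by positivity, ?_⟩
  have ht : Filter.Tendsto (fun x : ℕ => (x:ℝ) ^ θ) Filter.atTop Filter.atTop :=
    (tendsto_rpow_atTop hθ0).comp tendsto_natCast_atTop_atTop
  filter_upwards [ht.eventually_gt_atTop (2 / d), Filter.eventually_ge_atTop 1] with x hx hx1
  set k := Nat.log g x with hk
  have hk1 : g ^ k ≤ x := Nat.pow_log_le_self g (by omega)
  have hk2 : x < g ^ (k+1) := Nat.lt_pow_succ_log_self (by omega) x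
  have hk1R : (g:ℝ) ^ (k:ℝ) ≤ x := by rw [Real.rpow_natCast]; exact_mod_cast hk1
  have hk2R : (x:ℝ) ≤ (g:ℝ) ^ ((k:ℝ)+1) := by
    have : ((k:ℝ)+1) = ((k+1:ℕ):ℝ) := by push_cast; ring
    rw [this, Real.rpow_natCast]; exact_mod_cast hk2.le
  have hCk := abs_le.1 (hC k)
  rw [countFn_eq_wCount] at hCk
  have hxpos : (0:ℝ) < x := by exact_mod_cast hx1
  have hxθ : 0 < (x:ℝ) ^ θ := Real.rpow_pos_of_pos hxpos _
  constructor
  · have h1 : ((g:ℝ) ^ wCount W k) ≤ countFn (AgSet g W) x + 1 := by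
      exact_mod_cast count_lower g hg W k x hk1
    have h2 : (wCount W (k+1) : ℝ) ≤ wCount W k + 1 := by
      classical
      rw [wCount_succ]
      split_ifs <;> simp
    have h3 : d * (x:ℝ) ^ θ ≤ (g:ℝ) ^ wCount W k := by
      calc d * (x:ℝ) ^ θ ≤ d * ((g:ℝ) ^ ((k:ℝ)+1)) ^ θ := by gcongr
        _ = (g:ℝ) ^ ((-C - 1 - θ) + ((k:ℝ)+1) * θ) := by
          rw [← Real.rpow_mul hg0.le, hd, ← Real.rpow_add hg0]
        _ ≤ (g:ℝ) ^ (wCount W k : ℝ) := by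
          apply Real.rpow_le_rpow_of_exponent_le hg1
          nlinarith [hCk.1]
        _ = _ := Real.rpow_natCast _ _
    have h4 : 2 < (x:ℝ) ^ θ * d := (div_lt_iff₀ hdpos).1 hx
    linarith
  · have h1 : (countFn (AgSet g W) x : ℝ) ≤ (g:ℝ) ^ wCount W (k+1) := by
      exact_mod_cast count_upper g hg W (k+1) x hk2
    have h3 : (g:ℝ) ^ wCount W (k+1) ≤ (g:ℝ) ^ C * (x:ℝ) ^ θ := by
      calc (g:ℝ) ^ wCount W (k+1) = (g:ℝ) ^ (wCount W (k+1) : ℝ) := (Real.rpow_natCast _ _).symm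
        _ ≤ (g:ℝ) ^ (C + (k:ℝ) * θ) := by
          apply Real.rpow_le_rpow_of_exponent_le hg1
          nlinarith [hCk.2]
        _ = (g:ℝ) ^ C * ((g:ℝ) ^ (k:ℝ)) ^ θ := by
          rw [Real.rpow_add hg0, Real.rpow_mul hg0.le]
        _ ≤ _ := by gcongr
    linarith
end

section
/- Let g ≥ 2, h, and t be integers with t ≥ 2 and g^t ≤ h. Let (m_i)_{i≥1} be a sequence of integers with m_1 > g^{h+2} and m_{i+1} − m_i > g^{h+2} for all i ≥ 1. Define W_0 = [0, m_1] ∪ ⋃_{i≥1} [m_i+t+1, m_{i+1}] and, for j = 1, …, h−1, W_j = ⋃_{i ≥ 1, i ≡ j (mod h−1)} [m_i+1, m_i+t], where [a,b] denotes the set of integers in the interval [a,b]. Let A = A_g(W_0) ∪ A_g(W_1) ∪ ⋯ ∪ A_g(W_{h-1}). Then g^2 ∈ A_g(W_0) ⊆ A, and A \ {g^2} is an asymptotic basis of order h; consequently A is not a minimal asymptotic basis of order h. -/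
open Finset in
theorem aux_mixed (g : ℕ) (p d : ℕ → ℕ) (hp0 : p 0 = 0) (hp : ∀ i, p (i+1) = p i + d i)
    (n N : ℕ) : ∑ i ∈ range N, (n / g ^ p i % g ^ d i) * g ^ p i = n % g ^ p N := by
  induction N with
  | zero => simp [hp0, Nat.mod_one]
  | succ N ih =>
    rw [sum_range_succ, ih, hp, pow_add, Nat.mod_mul]
    ring

theorem aux_digits_mem (g : ℕ) (hg : 2 ≤ g) (W : Set ℕ) (x : ℕ) (hx : x ≠ 0)
    (h : ∀ f, x / g ^ f % g ≠ 0 → f ∈ W) : x ∈ AgSet g W := by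
  have key := aux_mixed g (fun i => i) (fun _ => 1) rfl (fun _ => rfl) x x
  rw [Nat.mod_eq_of_lt (Nat.lt_pow_self (by omega))] at key
  simp only [pow_one] at key
  have key2 : x = ∑ f ∈ (Finset.range x).filter (fun f => x / g ^ f % g ≠ 0),
      (x / g ^ f % g) * g ^ f := by
    rw [Finset.sum_filter_of_ne]
    · exact key.symm
    · intro f _ hne h0
      rw [h0] at hne
      simp at hne
  refine ⟨(Finset.range x).filter (fun f => x / g ^ f % g ≠ 0), ?_, ?_,
    fun f => x / g ^ f % g, ?_, key2⟩
  · rw [Finset.nonempty_iff_ne_empty]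
    intro h0
    rw [h0] at key2
    simp at key2
    exact hx key2
  · intro f hf
    simp only [Finset.coe_filter, Set.mem_ofPred_eq] at hf
    exact h f hf.2
  · intro f hf
    rw [Finset.mem_filter] at hf
    have := Nat.mod_lt (x / g ^ f) (show 0 < g by omega)
    have := hf.2
    show 1 ≤ x / g ^ f % g ∧ x / g ^ f % g ≤ g - 1
    omega

theorem aux_digit_add (g : ℕ) (hg : 2 ≤ g) (W : Set ℕ) (x y p l : ℕ) (hx : x < g ^ p)
    (hy : y < g ^ l) (h : ∀ f, x / g ^ f % g ≠ 0 → f ∈ W)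
    (hW : y ≠ 0 → ∀ f, p ≤ f → f < p + l → f ∈ W) :
    ∀ f, (x + y * g ^ p) / g ^ f % g ≠ 0 → f ∈ W := by
  intro f hf
  have hgf : ∀ a, 0 < g ^ a := fun a => pow_pos (by omega) a
  rcases lt_or_ge f p with hfp | hfp
  · apply h
    obtain ⟨e, rfl⟩ : ∃ e, p = f + (e + 1) := ⟨p - f - 1, by omega⟩
    have : (x + y * g ^ (f + (e+1))) / g ^ f = x / g ^ f + g * (y * g ^ e) := by
      rw [show y * g ^ (f + (e+1)) = g ^ f * (g * (y * g ^ e)) by ring,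
        Nat.add_mul_div_left _ _ (hgf f)]
    rw [this, Nat.add_mul_mod_self_left] at hf
    exact hf
  · obtain ⟨e, rfl⟩ : ∃ e, f = p + e := ⟨f - p, by omega⟩
    have : (x + y * g ^ p) / g ^ (p + e) = y / g ^ e := by
      rw [pow_add, ← Nat.div_div_eq_div_mul, Nat.add_mul_div_right _ _ (hgf p),
        Nat.div_eq_of_lt hx, zero_add]
    rw [this] at hf
    have hy0 : y ≠ 0 := by
      rintro rfl
      simp at hf
    apply hW hy0 _ (by omega)
    by_contra hc
    have : y < g ^ e := lt_of_lt_of_le hy (Nat.pow_le_pow_right (by omega) (by omega))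
    rw [Nat.div_eq_of_lt this] at hf
    simp at hf

open Finset in
theorem aux_sum_digits (g : ℕ) (hg : 2 ≤ g) (W : Set ℕ) (z e l : ℕ → ℕ)
    (hz : ∀ i, z i < g ^ l i) (he : ∀ i, e i + l i ≤ e (i+1))
    (hW : ∀ i, z i ≠ 0 → ∀ f, e i ≤ f → f < e i + l i → f ∈ W) (N : ℕ) :
    (∑ i ∈ range N, z i * g ^ e i) < g ^ e N ∧
    ∀ f, (∑ i ∈ range N, z i * g ^ e i) / g ^ f % g ≠ 0 → f ∈ W := by
  induction N with
  | zero => simp; positivity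
  | succ N ih =>
    rw [sum_range_succ]
    refine ⟨?_, aux_digit_add g hg W _ _ _ _ ih.1 (hz N) ih.2 (hW N)⟩
    calc _ < g ^ e N + z N * g ^ e N := by have := ih.1; omega
      _ = (z N + 1) * g ^ e N := by ring
      _ ≤ g ^ l N * g ^ e N := Nat.mul_le_mul_right _ (hz N)
      _ = g ^ (e N + l N) := by rw [pow_add, mul_comm]
      _ ≤ _ := Nat.pow_le_pow_right (by omega) (he N)

open Finset in
theorem aux_sum_mem (g : ℕ) (hg : 2 ≤ g) (W : Set ℕ) (z e l : ℕ → ℕ)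
    (hz : ∀ i, z i < g ^ l i) (he : ∀ i, e i + l i ≤ e (i+1)) (N : ℕ)
    (hW : ∀ i, z i ≠ 0 → ∀ f, e i ≤ f → f < e i + l i → f ∈ W)
    (h0 : (∑ i ∈ range N, z i * g ^ e i) ≠ 0) :
    (∑ i ∈ range N, z i * g ^ e i) ∈ AgSet g W :=
  aux_digits_mem g hg W _ h0 (aux_sum_digits g hg W z e l hz he hW N).2

open Finset in
theorem aux_split (k : ℕ) (hk : 0 < k) (q : ℕ) : ∑ l ∈ range k, (q + l) / k = q := by
  induction q with
  | zero =>
    apply sum_eq_zero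
    intro l hl
    rw [mem_range] at hl
    exact Nat.div_eq_of_lt (by omega)
  | succ q ih =>
    have h1 := sum_range_succ (fun l => (q + l) / k) k
    have h2 := sum_range_succ' (fun l => (q + l) / k) k
    rw [h1, ih, Nat.add_div_right _ hk] at h2
    have h3 : ∑ l ∈ range k, (q + 1 + l) / k = ∑ l ∈ range k, (q + (l + 1)) / k :=
      sum_congr rfl (fun l _ => by rw [show q + 1 + l = q + (l+1) by ring])
    rw [h3]
    simp only [add_zero] at h2
    omega

theorem aux_fold_add (a b : ℕ) (A : Set ℕ) (x y : ℕ) (hx : x ∈ FoldSum a A)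
    (hy : y ∈ FoldSum b A) : x + y ∈ FoldSum (a + b) A := by
  obtain ⟨u, hu, rfl⟩ := hx
  obtain ⟨v, hv, rfl⟩ := hy
  refine ⟨Fin.append u v, ?_, ?_⟩
  · intro i
    refine Fin.addCases (fun i => ?_) (fun i => ?_) i
    · simpa using hu i
    · simpa using hv i
  · rw [Fin.sum_univ_add]
    simp

theorem aux_fold_sum (A : Set ℕ) (S : Finset ℕ) (f : ℕ → ℕ) (h : ∀ i ∈ S, f i ∈ A) :
    ∑ i ∈ S, f i ∈ FoldSum S.card A := by
  refine ⟨fun i => f (S.equivFin.symm i), fun i => h _ (S.equivFin.symm i).2, ?_⟩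
  rw [Equiv.sum_comp S.equivFin.symm (fun i : S => f i), Finset.sum_coe_sort]

/-- Residue classes of nonzero blocks. -/
def auxJ (M N : ℕ) (b : ℕ → ℕ) : Finset ℕ :=
  ((Finset.range N).filter (fun i => b i ≠ 0)).image (fun i => i % M)

open Finset in
theorem aux_key (g h t : ℕ) (hg : 2 ≤ g) (hh : 4 ≤ h) (p L : ℕ → ℕ)
    (hp : ∀ i, p (i+1) = p i + L i + t) (hL : ∀ i, h + 4 ≤ L i)
    (W : ℕ → Set ℕ) (hW0 : ∀ i f, p i ≤ f → f < p i + L i → f ∈ W 0)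
    (hWj : ∀ i f, p i + L i ≤ f → f < p i + L i + t → f ∈ W (i % (h-1) + 1))
    (A : Set ℕ) (hA : ∀ j < h, AgSet g (W j) ⊆ A)
    (N : ℕ) (q b : ℕ → ℕ) (hb : ∀ i, b i < g ^ t) (k : ℕ)
    (hk : k + (auxJ (h-1) N b).card = h)
    (hq : ∀ i, q i ≤ k * (g ^ L i - 1)) (i0 : ℕ) (hi0 : i0 < N)
    (hqi : k * (g ^ 2 + 1) ≤ q i0) :
    ∑ i ∈ range N, (q i * g ^ p i + b i * g ^ (p i + L i)) ∈ FoldSum h (A \ {g ^ 2}) := by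
  have hgf : ∀ a, 0 < g ^ a := fun a => pow_pos (by omega) a
  have hJ : (auxJ (h-1) N b).card ≤ h - 1 := by
    have : auxJ (h-1) N b ⊆ range (h-1) := by
      intro j hj
      simp only [auxJ, mem_image, mem_filter] at hj
      obtain ⟨i, _, rfl⟩ := hj
      exact mem_range.2 (Nat.mod_lt _ (by omega))
    simpa using card_le_card this
  have hk0 : 0 < k := by omega
  rw [sum_add_distrib]
  have e1 : ∑ i ∈ range N, q i * g ^ p i =
      ∑ l ∈ range k, ∑ i ∈ range N, ((q i + l) / k) * g ^ p i := by
    rw [sum_comm]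
    apply sum_congr rfl
    intro i _
    rw [← sum_mul, aux_split k hk0]
  have e2 : ∑ i ∈ range N, b i * g ^ (p i + L i) = ∑ j ∈ auxJ (h-1) N b,
      ∑ i ∈ range N, (if i % (h-1) = j then b i else 0) * g ^ (p i + L i) := by
    rw [sum_comm]
    apply sum_congr rfl
    intro i hi
    rw [← sum_mul, sum_ite_eq]
    split_ifs with hc
    · rfl
    · have : b i = 0 := by
        by_contra hne
        exact hc (mem_image.2 ⟨i, mem_filter.2 ⟨hi, hne⟩, rfl⟩)
      rw [this]
  rw [e1, e2]
  suffices hsuf : _ ∈ FoldSum (k + (auxJ (h-1) N b).card) (A \ {g ^ 2}) by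
    rw [hk] at hsuf
    exact hsuf
  apply aux_fold_add
  · have := aux_fold_sum (A \ {g ^ 2}) (range k)
      (fun l => ∑ i ∈ range N, ((q i + l) / k) * g ^ p i) ?_
    · simpa using this
    · intro l hl
      rw [mem_range] at hl
      have hbig : g ^ 2 + 1 ≤ ∑ i ∈ range N, ((q i + l) / k) * g ^ p i := by
        calc g ^ 2 + 1 ≤ (q i0 + l) / k := by
              rw [Nat.le_div_iff_mul_le hk0]
              linarith
          _ ≤ (q i0 + l) / k * g ^ p i0 := Nat.le_mul_of_pos_right _ (hgf _)
          _ ≤ _ := single_le_sum (f := fun i => ((q i + l) / k) * g ^ p i)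
              (fun i _ => Nat.zero_le _) (mem_range.2 hi0)
      refine ⟨hA 0 (by omega) ?_, ?_⟩
      · apply aux_sum_mem g hg (W 0) (fun i => (q i + l) / k) p L
        · intro i
          show (q i + l) / k < _
          rw [Nat.div_lt_iff_lt_mul hk0]
          have h1 := hq i
          have h2 := hgf (L i)
          obtain ⟨c, hc⟩ : ∃ c, g ^ L i = c + 1 := ⟨g ^ L i - 1, by omega⟩
          rw [hc] at h1 ⊢
          simp only [Nat.add_sub_cancel] at h1
          nlinarith
        · intro i
          rw [hp]; omega
        · intro i _ f
          exact hW0 i f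
        · omega
      · rw [Set.mem_singleton_iff]
        omega
  · apply aux_fold_sum
    intro j hj
    simp only [auxJ, mem_image, mem_filter] at hj
    obtain ⟨i, ⟨hiN, hbi⟩, hij⟩ := hj
    have hjh : j < h - 1 := by rw [← hij]; exact Nat.mod_lt _ (by omega)
    have hbig : g ^ 2 < ∑ i ∈ range N, (if i % (h-1) = j then b i else 0) * g ^ (p i + L i) := by
      calc g ^ 2 < g ^ (p i + L i) := Nat.pow_lt_pow_right (by omega) (by have := hL i; omega)
        _ ≤ (if i % (h-1) = j then b i else 0) * g ^ (p i + L i) := by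
            rw [if_pos hij]
            exact Nat.le_mul_of_pos_left _ (Nat.pos_of_ne_zero hbi)
        _ ≤ _ := single_le_sum
              (f := fun i => (if i % (h-1) = j then b i else 0) * g ^ (p i + L i))
              (fun i _ => Nat.zero_le _) hiN
    refine ⟨hA (j+1) (by omega) ?_, ?_⟩
    · apply aux_sum_mem g hg (W (j+1)) (fun i => if i % (h-1) = j then b i else 0)
        (fun i => p i + L i) (fun _ => t)
      · intro i
        show (if i % (h-1) = j then b i else 0) < _
        split_ifs
        · exact hb i
        · exact hgf t
      · intro i
        simp only [hp]; omega
      · intro i hne f h1 h2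
        have : i % (h-1) = j := by
          by_contra hc
          simp [hc] at hne
        rw [← this]
        exact hWj i f h1 h2
      · omega
    · rw [Set.mem_singleton_iff]
      omega

theorem auxJ_mono (M N : ℕ) (b b' : ℕ → ℕ) (h : ∀ i, b' i ≠ 0 → b i ≠ 0) :
    (auxJ M N b').card ≤ (auxJ M N b).card := by
  apply Finset.card_le_card
  apply Finset.image_subset_image
  intro i hi
  rw [Finset.mem_filter] at hi ⊢
  exact ⟨hi.1, h i hi.2⟩

theorem aux_pow_big (g h L : ℕ) (hg : 2 ≤ g) (hL : h + 4 ≤ L) :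
    h * (g ^ 2 + 1) + h + 2 ≤ g ^ L := by
  have h1 : h + 1 ≤ g ^ h := Nat.lt_pow_self (by omega)
  calc h * (g ^ 2 + 1) + h + 2 ≤ (h + 1) * g ^ 4 := by
        have : 4 ≤ g ^ 2 := by nlinarith
        have e : g ^ 4 = g ^ 2 * g ^ 2 := by ring
        rw [e]
        generalize g ^ 2 = x at *
        nlinarith [Nat.mul_le_mul this this, Nat.mul_le_mul_left h (Nat.mul_le_mul_right x this)]
    _ ≤ g ^ h * g ^ 4 := Nat.mul_le_mul_right _ h1
    _ = g ^ (h + 4) := by rw [pow_add]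
    _ ≤ g ^ L := Nat.pow_le_pow_right (by omega) hL

open Finset in
theorem aux_main (g h t : ℕ) (hg : 2 ≤ g) (hh : 4 ≤ h) (hth : g ^ t ≤ h) (p L : ℕ → ℕ)
    (hp0 : p 0 = 0)
    (hp : ∀ i, p (i+1) = p i + L i + t) (hL : ∀ i, h + 4 ≤ L i)
    (W : ℕ → Set ℕ) (hW0 : ∀ i f, p i ≤ f → f < p i + L i → f ∈ W 0)
    (hWj : ∀ i f, p i + L i ≤ f → f < p i + L i + t → f ∈ W (i % (h-1) + 1))
    (A : Set ℕ) (hA : ∀ j < h, AgSet g (W j) ⊆ A)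
    (n : ℕ) (hn : g ^ p 1 ≤ n) : n ∈ FoldSum h (A \ {g ^ 2}) := by
  have hgf : ∀ a, 0 < g ^ a := fun a => pow_pos (by omega) a
  have hpn : ∀ i, i ≤ p i := by
    intro i
    induction i with
    | zero => omega
    | succ i ih => rw [hp]; have := hL i; omega
  have hnN : n < g ^ p n := lt_of_lt_of_le (Nat.lt_pow_self (by omega : 1 < g))
    (Nat.pow_le_pow_right (by omega) (hpn n))
  obtain ⟨s, hs⟩ : ∃ s : ℕ → ℕ, s = fun i => n / g ^ p i % g ^ (L i + t) % g ^ L i := ⟨_, rfl⟩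
  obtain ⟨b, hb⟩ : ∃ b : ℕ → ℕ, b = fun i => n / g ^ p i % g ^ (L i + t) / g ^ L i := ⟨_, rfl⟩
  have hslt : ∀ i, s i < g ^ L i := by
    intro i; rw [hs]; exact Nat.mod_lt _ (hgf _)
  have hblt : ∀ i, b i < g ^ t := by
    intro i; rw [hb]
    show _ / _ < _
    rw [Nat.div_lt_iff_lt_mul (hgf _), ← pow_add, add_comm t]
    exact Nat.mod_lt _ (hgf _)
  have hsum : n = ∑ i ∈ range n, (s i * g ^ p i + b i * g ^ (p i + L i)) := by
    have h1 := aux_mixed g p (fun i => L i + t) hp0 (fun i => by rw [hp]; ring) n n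
    rw [Nat.mod_eq_of_lt hnN] at h1
    conv_lhs => rw [← h1]
    apply sum_congr rfl
    intro i _
    rw [hs, hb]
    simp only
    conv_lhs => rw [← Nat.mod_add_div (n / g ^ p i % g ^ (L i + t)) (g ^ L i)]
    ring
  have hbig : ∀ i, h * (g ^ 2 + 1) + h + 2 ≤ g ^ L i := fun i => aux_pow_big g h _ hg (hL i)
  clear hs hb
  have hJle : ∀ b, (auxJ (h-1) n b).card ≤ h - 1 := by
    intro b
    have : auxJ (h-1) n b ⊆ range (h-1) := by
      intro j hj
      simp only [auxJ, mem_image, mem_filter] at hj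
      obtain ⟨i, _, rfl⟩ := hj
      exact mem_range.2 (Nat.mod_lt _ (by omega))
    simpa using card_le_card this
  have key := aux_key g h t hg hh p L hp hL W hW0 hWj A hA n
  obtain ⟨k, hk⟩ : ∃ k, k + (auxJ (h-1) n b).card = h :=
    ⟨h - (auxJ (h-1) n b).card, by have := hJle b; omega⟩
  have hk1 : 1 ≤ k := by have := hJle b; omega
  -- bound for ordinary coefficients
  have hmul : ∀ k', 1 ≤ k' → ∀ i, s i ≤ k' * (g ^ L i - 1) := by
    intro k' hk' i
    have h1 : s i ≤ g ^ L i - 1 := by have := hslt i; omega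
    calc s i ≤ g ^ L i - 1 := h1
      _ ≤ _ := Nat.le_mul_of_pos_left _ hk'
  by_cases c1 : ∃ i < n, k * (g ^ 2 + 1) ≤ s i
  · obtain ⟨i0, hi0, hc⟩ := c1
    have := key s b hblt k hk (hmul k hk1) i0 hi0 hc
    rwa [← hsum] at this
  push Not at c1
  have hkh : ∀ k' ≤ h, k' * (g ^ 2 + 1) ≤ h * (g ^ 2 + 1) := fun k' hk' =>
    Nat.mul_le_mul_right _ hk'
  -- bound for enlarged coefficients
  have hmul2 : ∀ k', 2 ≤ k' → ∀ i < n, s i + g ^ L i ≤ k' * (g ^ L i - 1) := by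
    intro k' hk' i hi
    have h1 := c1 i hi
    have h2 := hkh k (by omega)
    have h3 := hbig i
    calc s i + g ^ L i ≤ 2 * (g ^ L i - 1) := by omega
      _ ≤ _ := Nat.mul_le_mul_right _ hk'
  by_cases c2 : ∃ i < n, b i ≠ 0
  · obtain ⟨i0, hi0, hbi⟩ := c2
    by_cases hk2 : 2 ≤ k
    · -- move one unit of block `i0` down
      have hJ' := auxJ_mono (h-1) n b (Function.update b i0 (b i0 - 1)) (by
        intro i hi
        by_cases hii : i = i0
        · rw [hii]; exact hbi
        · rwa [Function.update_of_ne hii] at hi)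
      have hJ'' := hJle (Function.update b i0 (b i0 - 1))
      obtain ⟨k', hk'⟩ : ∃ k', k' + (auxJ (h-1) n (Function.update b i0 (b i0 - 1))).card = h :=
        ⟨_, Nat.sub_add_cancel (by omega)⟩
      have := key (Function.update s i0 (s i0 + g ^ L i0)) (Function.update b i0 (b i0 - 1))
        (by
          intro i
          by_cases hii : i = i0
          · rw [hii, Function.update_self]; have := hblt i0; omega
          · rw [Function.update_of_ne hii]; exact hblt i) k' hk'
        (by
          intro i
          by_cases hii : i = i0
          · rw [hii, Function.update_self]; exact hmul2 k' (by omega) i0 hi0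
          · rw [Function.update_of_ne hii]; exact hmul k' (by omega) i) i0 hi0
        (by
          rw [Function.update_self]
          have := hkh k' (by omega)
          have := hbig i0
          omega)
      convert this using 1
      conv_lhs => rw [hsum]
      apply sum_congr rfl
      intro i _
      by_cases hii : i = i0
      · rw [hii, Function.update_self, Function.update_self]
        obtain ⟨c, hc⟩ : ∃ c, b i0 = c + 1 := ⟨b i0 - 1, by omega⟩
        rw [hc, Nat.add_sub_cancel]
        ring
      · rw [Function.update_of_ne hii, Function.update_of_ne hii]
    · -- move everything down
      have hk1' : k = 1 := by omega
      subst hk1'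
      have hJ0 : (auxJ (h-1) n (fun _ => 0)).card = 0 := by simp [auxJ]
      have := key (fun i => if i < n then s i + b i * g ^ L i else 0) (fun _ => 0)
        (fun _ => hgf t) h (by rw [hJ0]; rfl)
        (by
          intro i
          show (if i < n then s i + b i * g ^ L i else 0) ≤ _
          split_ifs with hi
          · have h1 := c1 i hi
            have h2 := hkh 1 (by omega)
            have h3 := hbig i
            have h4 : b i + 1 ≤ g ^ t := hblt i
            obtain ⟨d, hd⟩ : ∃ d, g ^ L i = d + 1 := ⟨g ^ L i - 1, by omega⟩
            rw [hd] at h3 ⊢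
            rw [Nat.add_sub_cancel]
            have h5 : (b i + 1) * d ≤ h * d := Nat.mul_le_mul_right _ (h4.trans hth)
            have h6 : (b i + 1) * d = b i * d + d := by ring
            have h7 : b i * (d + 1) = b i * d + b i := by ring
            omega
          · exact Nat.zero_le _) i0 hi0
        (by
          simp only [hi0, if_true]
          have := hbig i0
          have : g ^ L i0 ≤ b i0 * g ^ L i0 := Nat.le_mul_of_pos_left _ (by omega)
          omega)
      convert this using 1
      conv_lhs => rw [hsum]
      apply sum_congr rfl
      intro i hi
      rw [mem_range] at hi
      simp only [hi, if_true]
      ring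
  · push Not at c2
    have hJ0 : (auxJ (h-1) n b).card = 0 := by
      rw [card_eq_zero, auxJ, image_eq_empty, filter_eq_empty_iff]
      intro i hi hne
      exact hne (c2 i (mem_range.1 hi))
    -- some higher segment is nonzero
    have c3 : ∃ i, i + 1 < n ∧ s (i + 1) ≠ 0 := by
      by_contra hc
      push Not at hc
      have hn0 : 0 < n := lt_of_lt_of_le (hgf _) hn
      have : ∑ i ∈ range n, (s i * g ^ p i + b i * g ^ (p i + L i)) = s 0 := by
        rw [sum_eq_single 0]
        · rw [c2 0 hn0, hp0]; simp
        · intro i hi hi0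
          rw [mem_range] at hi
          obtain ⟨j, rfl⟩ : ∃ j, i = j + 1 := ⟨i - 1, by omega⟩
          rw [c2 _ hi, hc j hi]; simp
        · intro hne
          exact absurd (mem_range.2 hn0) hne
      rw [← hsum] at this
      have h1 := hslt 0
      have h2 : g ^ L 0 ≤ g ^ p 1 := Nat.pow_le_pow_right (by omega) (by rw [hp]; omega)
      omega
    obtain ⟨i0, hi0, hsi⟩ := c3
    let b' : ℕ → ℕ := fun i => if i = i0 then g ^ t - 1 else 0
    let s' : ℕ → ℕ := fun i => if i = i0 then s i + g ^ L i else
      if i = i0 + 1 then s i - 1 else s i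
    have hJ1 : (auxJ (h-1) n b').card ≤ 1 := by
      rw [card_le_one]
      intro x hx y hy
      simp only [auxJ, mem_image, mem_filter, b'] at hx hy
      obtain ⟨i, ⟨_, hi⟩, rfl⟩ := hx
      obtain ⟨j, ⟨_, hj⟩, rfl⟩ := hy
      have h1 : i = i0 := by by_contra hne; simp [hne] at hi
      have h2 : j = i0 := by by_contra hne; simp [hne] at hj
      rw [h1, h2]
    obtain ⟨k', hk'⟩ : ∃ k', k' + (auxJ (h-1) n b').card = h :=
      ⟨_, Nat.sub_add_cancel (by omega)⟩
    have := key s' b'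
      (by
        intro i
        have := hgf t
        show (if i = i0 then g ^ t - 1 else 0) < _
        split_ifs <;> omega) k' hk'
      (by
        intro i
        have h1 := hmul k' (by omega) i
        show (if i = i0 then s i + g ^ L i else if i = i0 + 1 then s i - 1 else s i) ≤ _
        split_ifs with h2 h3
        · rw [h2]; exact hmul2 k' (by omega) i0 (by omega)
        · omega
        · exact h1) i0 (by omega)
      (by
        simp only [s', if_true]
        have := hkh k' (by omega)
        have := hbig i0
        omega)
    convert this using 1
    conv_lhs => rw [hsum]
    -- split off the two affected indices
    have hm0 : i0 ∈ range n := mem_range.2 (by omega)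
    have hm1 : i0 + 1 ∈ (range n).erase i0 := mem_erase.2 ⟨by omega, mem_range.2 hi0⟩
    rw [← add_sum_erase _ _ hm0, ← add_sum_erase _ _ hm1,
      ← add_sum_erase (range n) (fun i => s' i * g ^ p i + b' i * g ^ (p i + L i)) hm0,
      ← add_sum_erase ((range n).erase i0)
        (fun i => s' i * g ^ p i + b' i * g ^ (p i + L i)) hm1]
    have hcomb : ∀ a b c a' b' c' : ℕ, a + b = a' + b' → c = c' →
        a + (b + c) = a' + (b' + c') := by
      intros; omega
    apply hcomb
    · simp only [s', b', if_true, Nat.succ_ne_self, if_false, show (i0 + 1 = i0) = False by simp, c2 i0 (by omega), c2 _ hi0]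
      obtain ⟨c, hc⟩ : ∃ c, s (i0 + 1) = c + 1 := ⟨s (i0+1) - 1, by omega⟩
      obtain ⟨d, hd⟩ : ∃ d, g ^ t = d + 1 := ⟨g ^ t - 1, by have := hgf t; omega⟩
      rw [hc, hp, pow_add g (p i0 + L i0), hd, Nat.add_sub_cancel, Nat.add_sub_cancel, pow_add]
      ring
    · apply sum_congr rfl
      intro i hi
      simp only [mem_erase, mem_range] at hi
      simp only [s', b', hi.1, hi.2.1, if_false, c2 i hi.2.2]

/-- In the setting of the construction of Theorem 1 (same `W j` as in
Statement 8), `g ^ 2 ∈ A_g(W 0) ⊆ A`, the set `A \ {g ^ 2}` is an asymptotic basis of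
order `h`, and consequently `A` is not a minimal asymptotic basis of order `h`. -/
theorem stmt9 (g h t : ℕ) (hg : 2 ≤ g) (ht : 2 ≤ t) (hth : g ^ t ≤ h)
    (m : ℕ → ℕ) (hm1 : g ^ (h + 2) < m 1)
    (hm : ∀ i : ℕ, 1 ≤ i → m i + g ^ (h + 2) < m (i + 1))
    (W : ℕ → Set ℕ)
    (hW0 : W 0 = Set.Icc 0 (m 1) ∪
      ⋃ i ∈ {i : ℕ | 1 ≤ i}, Set.Icc (m i + t + 1) (m (i + 1)))
    (hWj : ∀ j : ℕ, 1 ≤ j → j ≤ h - 1 →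
      W j = ⋃ i ∈ {i : ℕ | 1 ≤ i ∧ i % (h - 1) = j % (h - 1)}, Set.Icc (m i + 1) (m i + t))
    (A : Set ℕ) (hA : A = ⋃ j ∈ Finset.range h, AgSet g (W j)) :
    g ^ 2 ∈ AgSet g (W 0) ∧ AgSet g (W 0) ⊆ A ∧
      IsAsymptoticBasis h (A \ {g ^ 2}) ∧
      ¬ IsMinimalAsymptoticBasis h A := by
  have hh : 4 ≤ h := by
    have : g ^ 2 ≤ g ^ t := Nat.pow_le_pow_right (by omega) ht
    nlinarith
  have htlt : t < g ^ t := Nat.lt_pow_self (by omega)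
  have hbig : 4 * h + 4 ≤ g ^ (h + 2) := by
    have h1 : h + 1 ≤ g ^ h := Nat.lt_pow_self (by omega)
    rw [pow_add]
    have h2 : 4 ≤ g ^ 2 := by nlinarith
    nlinarith [Nat.mul_le_mul h1 h2]
  have h1 : g ^ 2 ∈ AgSet g (W 0) := by
    refine ⟨{2}, by simp, ?_, fun _ => 1, ?_, by simp⟩
    · rw [hW0]
      intro f hf
      simp only [Finset.coe_singleton, Set.mem_singleton_iff] at hf
      left
      constructor <;> omega
    · intro f _
      show 1 ≤ 1 ∧ 1 ≤ g - 1
      omega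
  have hAj : ∀ j < h, AgSet g (W j) ⊆ A := by
    intro j hj x hx
    rw [hA]
    simp only [Set.mem_iUnion, Finset.mem_range]
    exact ⟨j, hj, hx⟩
  have h3 : IsAsymptoticBasis h (A \ {g ^ 2}) := by
    let p : ℕ → ℕ := fun i => if i = 0 then 0 else m i + t + 1
    let L : ℕ → ℕ := fun i => m (i + 1) + 1 - p i
    have hpS : ∀ i, p (i + 1) = m (i + 1) + t + 1 := fun i => by simp [p]
    have hp0 : p 0 = 0 := rfl
    have hpL : ∀ i, p i + h + 4 ≤ m (i + 1) + 1 := by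
      intro i
      rcases i with _ | i
      · rw [hp0]; simp only [zero_add]; omega
      · rw [hpS]; have := hm (i + 1) (by omega); omega
    have hLe : ∀ i, p i + L i = m (i + 1) + 1 := by
      intro i
      have := hpL i
      simp only [L]; omega
    apply Filter.eventually_atTop.2 ⟨g ^ p 1, ?_⟩
    intro n hn
    apply aux_main g h t hg hh hth p L hp0 _ _ W _ _ A hAj n hn
    · intro i
      rw [hLe, hpS]; omega
    · intro i
      have := hLe i
      have := hpL i
      omega
    · intro i f hf1 hf2
      rw [hLe] at hf2
      rw [hW0]
      rcases i with _ | i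
      · left
        simp only [zero_add] at hf2
        constructor <;> omega
      · right
        rw [hpS] at hf1
        simp only [Set.mem_iUnion, Set.mem_ofPred_eq]
        exact ⟨i + 1, by omega, by omega, by omega⟩
    · intro i f hf1 hf2
      rw [hLe] at hf1 hf2
      have := Nat.mod_lt i (show 0 < h - 1 by omega)
      rw [hWj (i % (h - 1) + 1) (by omega) (by omega)]
      simp only [Set.mem_iUnion, Set.mem_ofPred_eq]
      refine ⟨i + 1, ⟨by omega, ?_⟩, by omega, by omega⟩
      rw [Nat.mod_add_mod]
  have h2 : AgSet g (W 0) ⊆ A := hAj 0 (by omega)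
  refine ⟨h1, h2, h3, fun hmin => hmin.2 _ ?_ h3⟩
  refine ⟨Set.sdiff_subset, fun hs => ?_⟩
  exact (hs (h2 h1)).2 rfl
end
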